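/- arXiv:2104.12849 — 7 statements merged into one kernel-verified Lean document; each statement's English description precedes it below -/
import Mathlib

section
/- Let 𝔲 be a twice continuously differentiable solution of the generalized massless Dirac/Thirring equation ∂ₜ𝔲 − 𝔞 ∂ₓ𝔲 = −i A(t,x) 𝔲 on ℝ × ℝ. Then the real-valued function w(t,x) = |𝔲(t,x)|² = 𝔲(t,x)†𝔲(t,x) satisfies the one-dimensional wave equation ∂ₜₜ w − ∂ₓₓ w = 0 on ℝ × ℝ. -/
open Matrix

/-- Derivative of a Hermitian quadratic form along a curve. -/
lemma deriv_quad (M : Matrix (Fin 2) (Fin 2) ℂ) (hM : Mᴴ = M) (g : ℝ → Fin 2 → ℂ) (t : ℝ)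
    (hg : DifferentiableAt ℝ g t) :
    deriv (fun s => (star (g s) ⬝ᵥ M *ᵥ g s).re) t
      = 2 * (star (g t) ⬝ᵥ M *ᵥ deriv g t).re := by
  have h := hasDerivAt_pi.1 hg.hasDerivAt
  have hq : HasDerivAt (fun s => star (g s) ⬝ᵥ M *ᵥ g s)
      (star (deriv g t) ⬝ᵥ M *ᵥ g t + star (g t) ⬝ᵥ M *ᵥ deriv g t) t := by
    have h1 : HasDerivAt (fun s => ∑ i, star (g s i) * ∑ j, M i j * g s j)
      (∑ i, (star (deriv g t i) * (∑ j, M i j * g t j)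
        + star (g t i) * ∑ j, M i j * deriv g t j)) t := by
      refine HasDerivAt.fun_sum fun i _ => ?_
      refine (h i).star.mul ?_
      exact HasDerivAt.fun_sum fun j _ => (h j).const_mul _
    rw [Finset.sum_add_distrib] at h1
    exact h1
  have hre : HasDerivAt (fun s => (star (g s) ⬝ᵥ M *ᵥ g s).re)
      (star (deriv g t) ⬝ᵥ M *ᵥ g t + star (g t) ⬝ᵥ M *ᵥ deriv g t).re t :=
    Complex.reCLM.hasFDerivAt.comp_hasDerivAt t hq
  rw [hre.deriv]
  have : star (deriv g t) ⬝ᵥ M *ᵥ g t = star (star (g t) ⬝ᵥ M *ᵥ deriv g t) := by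
    rw [star_dotProduct, star_mulVec, hM, ← dotProduct_mulVec]
  rw [this, Complex.add_re]
  simp
  ring

/-- A Hermitian form takes real values. -/
lemma herm_re (M : Matrix (Fin 2) (Fin 2) ℂ) (hM : Mᴴ = M) (v : Fin 2 → ℂ) :
    (star v ⬝ᵥ (-(Complex.I • M *ᵥ v))).re = 0 := by
  have h : (star v ⬝ᵥ M *ᵥ v).im = 0 := Matrix.IsHermitian.im_star_dotProduct_mulVec_self hM v
  rw [dotProduct_neg, dotProduct_smul, smul_eq_mul, Complex.neg_re, Complex.I_mul_re, h]
  simp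

/-- Partial derivatives as values of the Fréchet derivative. -/
lemma hasDerivAt_fst {E : Type*} [NormedAddCommGroup E] [NormedSpace ℝ E] (f : ℝ × ℝ → E)
    (t x : ℝ) (hf : DifferentiableAt ℝ f (t, x)) :
    HasDerivAt (fun s => f (s, x)) (fderiv ℝ f (t, x) (1, 0)) t :=
  hf.hasFDerivAt.comp_hasDerivAt t ((hasDerivAt_id t).prodMk (hasDerivAt_const t x))

lemma hasDerivAt_snd {E : Type*} [NormedAddCommGroup E] [NormedSpace ℝ E] (f : ℝ × ℝ → E)
    (t x : ℝ) (hf : DifferentiableAt ℝ f (t, x)) :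
    HasDerivAt (fun y => f (t, y)) (fderiv ℝ f (t, x) (0, 1)) x :=
  hf.hasFDerivAt.comp_hasDerivAt x ((hasDerivAt_const x t).prodMk (hasDerivAt_id x))

lemma deriv_swap (f : ℝ × ℝ → ℝ) (hf : ContDiff ℝ 2 f) (t x : ℝ) :
    deriv (fun s => deriv (fun y => f (s, y)) x) t
      = deriv (fun y => deriv (fun s => f (s, y)) t) x := by
  have hd : Differentiable ℝ f := hf.differentiable (by norm_num)
  have hd2 : Differentiable ℝ (fderiv ℝ f) :=
    (hf.fderiv_right (m := 1) (by norm_num)).differentiable (by norm_num)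
  have e1 : (fun s => deriv (fun y => f (s, y)) x) = fun s => fderiv ℝ f (s, x) (0, 1) :=
    funext fun s => (hasDerivAt_snd f s x (hd _)).deriv
  have e2 : (fun y => deriv (fun s => f (s, y)) t) = fun y => fderiv ℝ f (t, y) (1, 0) :=
    funext fun y => (hasDerivAt_fst f t y (hd _)).deriv
  have h1 := (hasDerivAt_fst (fderiv ℝ f) t x (hd2 _)).clm_apply (hasDerivAt_const t ((0:ℝ), (1:ℝ)))
  have h2 := (hasDerivAt_snd (fderiv ℝ f) t x (hd2 _)).clm_apply (hasDerivAt_const x ((1:ℝ), (0:ℝ)))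
  rw [e1, e2, h1.deriv, h2.deriv]
  have hs : IsSymmSndFDerivAt ℝ f (t, x) :=
    hf.contDiffAt.isSymmSndFDerivAt (by simp)
  simpa using hs (1, 0) (0, 1)

/-- If `𝔲` is a twice continuously differentiable solution of the
generalized massless Dirac/Thirring equation `∂ₜ𝔲 − 𝔞 ∂ₓ𝔲 = −i A(t,x) 𝔲` on `ℝ × ℝ`,
where `𝔞` is Hermitian with `𝔞² = I` and `A(t,x)` is continuous, Hermitian and commutes
with `𝔞`, then the real-valued function `w = |𝔲|² = 𝔲†𝔲` satisfies the 1-d wave equation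
`∂ₜₜ w − ∂ₓₓ w = 0`. -/
theorem squared_modulus_satisfies_wave_equation
    (a : Matrix (Fin 2) (Fin 2) ℂ)
    (ha_herm : aᴴ = a) (ha_sq : a * a = 1)
    (A : ℝ → ℝ → Matrix (Fin 2) (Fin 2) ℂ)
    (hA_cont : Continuous (fun p : ℝ × ℝ => A p.1 p.2))
    (hA_herm : ∀ t x, (A t x)ᴴ = A t x)
    (hA_comm : ∀ t x, a * A t x = A t x * a)
    (u : ℝ → ℝ → Fin 2 → ℂ)
    (hu_smooth : ContDiff ℝ 2 (fun p : ℝ × ℝ => u p.1 p.2))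
    (hu_eq : ∀ t x : ℝ,
      deriv (fun s => u s x) t - a.mulVec (deriv (fun y => u t y) x)
        = -(Complex.I • (A t x).mulVec (u t x))) :
    ∀ t x : ℝ,
      deriv (fun s => deriv (fun s' => (star (u s' x) ⬝ᵥ u s' x).re) s) t
        - deriv (fun y => deriv (fun y' => (star (u t y') ⬝ᵥ u t y').re) y) x = 0 := by
  intro t x
  have hud : Differentiable ℝ (fun p : ℝ × ℝ => u p.1 p.2) :=
    hu_smooth.differentiable (by norm_num)
  have hut : ∀ t x, DifferentiableAt ℝ (fun s => u s x) t := fun t x =>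
    (hasDerivAt_fst _ t x (hud _)).differentiableAt
  have hux : ∀ t x, DifferentiableAt ℝ (fun y => u t y) x := fun t x =>
    (hasDerivAt_snd _ t x (hud _)).differentiableAt
  have heq : ∀ t x, deriv (fun s => u s x) t = a *ᵥ (deriv (fun y => u t y) x)
      + -(Complex.I • (A t x) *ᵥ (u t x)) := fun t x => by
    rw [← hu_eq t x]; abel
  have haA : ∀ t x, (a * A t x)ᴴ = a * A t x := fun t x => by
    rw [conjTranspose_mul, ha_herm, hA_herm, hA_comm]
  have hq1 : ∀ (g : ℝ → Fin 2 → ℂ) (t : ℝ), DifferentiableAt ℝ g t →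
      deriv (fun s => (star (g s) ⬝ᵥ g s).re) t = 2 * (star (g t) ⬝ᵥ deriv g t).re := by
    intro g t hg
    simpa using deriv_quad 1 (by simp) g t hg
  -- first conservation law
  have c1 : ∀ t x, deriv (fun s => (star (u s x) ⬝ᵥ u s x).re) t
      = deriv (fun y => (star (u t y) ⬝ᵥ a *ᵥ u t y).re) x := by
    intro t x
    rw [hq1 (fun s => u s x) t (hut t x), deriv_quad a ha_herm (fun y => u t y) x (hux t x), heq,
      dotProduct_add, Complex.add_re, herm_re _ (hA_herm t x), add_zero]
  -- second conservation law
  have c2 : ∀ t x, deriv (fun s => (star (u s x) ⬝ᵥ a *ᵥ u s x).re) t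
      = deriv (fun y => (star (u t y) ⬝ᵥ u t y).re) x := by
    intro t x
    rw [hq1 (fun y => u t y) x (hux t x), deriv_quad a ha_herm (fun s => u s x) t (hut t x), heq,
      mulVec_add, mulVec_neg, mulVec_smul, mulVec_mulVec, mulVec_mulVec, ha_sq, one_mulVec,
      dotProduct_add, Complex.add_re, herm_re _ (haA t x), add_zero]
  have hv : ContDiff ℝ 2 (fun p : ℝ × ℝ => (star (u p.1 p.2) ⬝ᵥ a *ᵥ u p.1 p.2).re) := by
    have hc := contDiff_pi.1 hu_smooth
    have : ContDiff ℝ 2 (fun p : ℝ × ℝ =>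
        ∑ i, star (u p.1 p.2 i) * ∑ j, a i j * u p.1 p.2 j) := by
      refine ContDiff.sum fun i _ => ContDiff.mul ?_ ?_
      · exact (starL' ℝ : ℂ ≃L[ℝ] ℂ).contDiff.comp (hc i)
      · exact ContDiff.sum fun j _ => contDiff_const.mul (hc j)
    exact Complex.reCLM.contDiff.comp this
  have hs := deriv_swap _ hv t x
  simp only [c1]
  simp only [← c2]
  exact sub_eq_zero.2 hs
end

section
/- Let 𝔲 be a twice continuously differentiable solution of the generalized massless Dirac/Thirring equation ∂ₜ𝔲 − 𝔞 ∂ₓ𝔲 = −i A(t,x) 𝔲 on ℝ × ℝ. Then the function w(t,x) = 𝔲(t,x)†𝔞𝔲(t,x) satisfies the one-dimensional wave equation ∂ₜₜ w − ∂ₓₓ w = 0 on ℝ × ℝ. -/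
open Matrix

theorem helper_hasDerivAt (M : Matrix (Fin 2) (Fin 2) ℂ) (f : ℝ → Fin 2 → ℂ) (v : Fin 2 → ℂ) (s : ℝ)
    (hf : HasDerivAt f v s) :
    HasDerivAt (fun r => star (f r) ⬝ᵥ M.mulVec (f r))
      (star v ⬝ᵥ M.mulVec (f s) + star (f s) ⬝ᵥ M.mulVec v) s := by
  have hc := hasDerivAt_pi.1 hf
  have h0 := hc 0
  have h1 := hc 1
  have k0 := h0.star
  have k1 := h1.star
  have := (k0.mul ((h0.const_mul (M 0 0)).add (h1.const_mul (M 0 1)))).add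
    (k1.mul ((h0.const_mul (M 1 0)).add (h1.const_mul (M 1 1))))
  have e : (fun r => star (f r) ⬝ᵥ M.mulVec (f r)) = fun r =>
      star (f r 0) * (M 0 0 * f r 0 + M 0 1 * f r 1)
        + star (f r 1) * (M 1 0 * f r 0 + M 1 1 * f r 1) := by
    funext r
    simp [dotProduct, mulVec, Fin.sum_univ_two]
  rw [e]
  refine HasDerivAt.congr_deriv this ?_
  simp [dotProduct, mulVec, Fin.sum_univ_two]
  ring

theorem helper_symm (f : ℝ × ℝ → ℂ) (hf : ContDiff ℝ 2 f) (t x : ℝ) :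
    deriv (fun s => deriv (fun y => f (s, y)) x) t
      = deriv (fun y => deriv (fun s => f (s, y)) t) x := by
  have hd : Differentiable ℝ f := hf.differentiable (by norm_num)
  have hd2 : Differentiable ℝ (fderiv ℝ f) :=
    (hf.fderiv_right (m := 1) (by norm_num)).differentiable (by norm_num)
  have hl1 : ∀ s y : ℝ, HasDerivAt (fun r : ℝ => (r, y)) ((1 : ℝ), (0 : ℝ)) s := fun s y =>
    (hasDerivAt_id s).prodMk (hasDerivAt_const s y)
  have hl2 : ∀ s y : ℝ, HasDerivAt (fun r : ℝ => (s, r)) ((0 : ℝ), (1 : ℝ)) y := fun s y =>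
    (hasDerivAt_const y s).prodMk (hasDerivAt_id y)
  have e1 : ∀ s y, deriv (fun r => f (r, y)) s = fderiv ℝ f (s, y) (1, 0) := fun s y =>
    ((hd (s, y)).hasFDerivAt.comp_hasDerivAt s (hl1 s y)).deriv
  have e2 : ∀ s y, deriv (fun r => f (s, r)) y = fderiv ℝ f (s, y) (0, 1) := fun s y =>
    ((hd (s, y)).hasFDerivAt.comp_hasDerivAt y (hl2 s y)).deriv
  simp only [e1, e2]
  have q1 : HasDerivAt (fun s => fderiv ℝ f (s, x)) (fderiv ℝ (fderiv ℝ f) (t, x) (1, 0)) t :=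
    (hd2 (t, x)).hasFDerivAt.comp_hasDerivAt t (hl1 t x)
  have q2 : HasDerivAt (fun y => fderiv ℝ f (t, y)) (fderiv ℝ (fderiv ℝ f) (t, x) (0, 1)) x :=
    (hd2 (t, x)).hasFDerivAt.comp_hasDerivAt x (hl2 t x)
  have g1 : HasDerivAt (fun s => fderiv ℝ f (s, x) (0, 1))
      (fderiv ℝ (fderiv ℝ f) (t, x) (1, 0) (0, 1)) t :=
    (ContinuousLinearMap.apply ℝ ℂ ((0 : ℝ), (1 : ℝ))).hasFDerivAt.comp_hasDerivAt t q1
  have g2 : HasDerivAt (fun y => fderiv ℝ f (t, y) (1, 0))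
      (fderiv ℝ (fderiv ℝ f) (t, x) (0, 1) (1, 0)) x :=
    (ContinuousLinearMap.apply ℝ ℂ ((1 : ℝ), (0 : ℝ))).hasFDerivAt.comp_hasDerivAt x q2
  have sy : IsSymmSndFDerivAt ℝ f (t, x) :=
    (hf.contDiffAt (x := (t, x))).isSymmSndFDerivAt (by simp)
  rw [g1.deriv, g2.deriv]
  exact sy _ _

theorem helper_alg1 (a A : Matrix (Fin 2) (Fin 2) ℂ) (ha : aᴴ = a) (hs : a * a = 1)
    (hA : Aᴴ = A) (hc : a * A = A * a) (u v w : Fin 2 → ℂ)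
    (h : w - a.mulVec v = -(Complex.I • A.mulVec u)) :
    star w ⬝ᵥ a.mulVec u + star u ⬝ᵥ a.mulVec w
      = star v ⬝ᵥ (1 : Matrix (Fin 2) (Fin 2) ℂ).mulVec u
        + star u ⬝ᵥ (1 : Matrix (Fin 2) (Fin 2) ℂ).mulVec v := by
  obtain rfl : w = a.mulVec v + -(Complex.I • A.mulVec u) := by rw [← h]; abel
  simp only [star_add, star_neg, star_smul, star_mulVec, ha, hA, mulVec_add, mulVec_neg,
    mulVec_smul, mulVec_mulVec, hs, add_dotProduct, neg_dotProduct, smul_dotProduct,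
    dotProduct_add, dotProduct_neg, dotProduct_smul, ← dotProduct_mulVec, hc, smul_eq_mul,
    Complex.star_def, Complex.conj_I]
  ring

theorem helper_alg2 (a A : Matrix (Fin 2) (Fin 2) ℂ) (ha : aᴴ = a)
    (hA : Aᴴ = A) (u v w : Fin 2 → ℂ)
    (h : w - a.mulVec v = -(Complex.I • A.mulVec u)) :
    star w ⬝ᵥ (1 : Matrix (Fin 2) (Fin 2) ℂ).mulVec u
        + star u ⬝ᵥ (1 : Matrix (Fin 2) (Fin 2) ℂ).mulVec w
      = star v ⬝ᵥ a.mulVec u + star u ⬝ᵥ a.mulVec v := by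
  obtain rfl : w = a.mulVec v + -(Complex.I • A.mulVec u) := by rw [← h]; abel
  simp only [star_add, star_neg, star_smul, star_mulVec, ha, hA, one_mulVec,
    add_dotProduct, neg_dotProduct, smul_dotProduct,
    dotProduct_add, dotProduct_neg, dotProduct_smul, ← dotProduct_mulVec, smul_eq_mul,
    Complex.star_def, Complex.conj_I]
  ring



/-- For a C² solution of the generalized massless Dirac/Thirring equation,
the function `w = 𝔲†𝔞𝔲` satisfies the one-dimensional wave equation `∂ₜₜw − ∂ₓₓw = 0`. -/
theorem dagger_a_satisfies_wave_equation
    (a : Matrix (Fin 2) (Fin 2) ℂ)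
    (ha_herm : aᴴ = a) (ha_sq : a * a = 1)
    (A : ℝ → ℝ → Matrix (Fin 2) (Fin 2) ℂ)
    (hA_cont : Continuous (fun p : ℝ × ℝ => A p.1 p.2))
    (hA_herm : ∀ t x, (A t x)ᴴ = A t x)
    (hA_comm : ∀ t x, a * A t x = A t x * a)
    (u : ℝ → ℝ → Fin 2 → ℂ)
    (hu_smooth : ContDiff ℝ 2 (fun p : ℝ × ℝ => u p.1 p.2))
    (hu_eq : ∀ t x : ℝ,
      deriv (fun s => u s x) t - a.mulVec (deriv (fun y => u t y) x)
        = -(Complex.I • (A t x).mulVec (u t x))) :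
    ∀ t x : ℝ,
      deriv (fun s => deriv (fun s' => star (u s' x) ⬝ᵥ a.mulVec (u s' x)) s) t
        - deriv (fun y => deriv (fun y' => star (u t y') ⬝ᵥ a.mulVec (u t y')) y) x = 0 := by
  intro t x
  have hd : Differentiable ℝ (fun p : ℝ × ℝ => u p.1 p.2) := hu_smooth.differentiable (by norm_num)
  have d1 : ∀ s y, HasDerivAt (fun r => u r y) (deriv (fun r => u r y) s) s := fun s y => by
    have : DifferentiableAt ℝ ((fun p : ℝ × ℝ => u p.1 p.2) ∘ fun r : ℝ => (r, y)) s :=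
      (hd _).comp s (by fun_prop)
    exact this.hasDerivAt
  have d2 : ∀ s y, HasDerivAt (fun r => u s r) (deriv (fun r => u s r) y) y := fun s y => by
    have : DifferentiableAt ℝ ((fun p : ℝ × ℝ => u p.1 p.2) ∘ fun r : ℝ => (s, r)) y :=
      (hd _).comp y (by fun_prop)
    exact this.hasDerivAt
  have c1 : ∀ s y, deriv (fun s' => star (u s' y) ⬝ᵥ a.mulVec (u s' y)) s
      = deriv (fun y' => star (u s y') ⬝ᵥ (1 : Matrix (Fin 2) (Fin 2) ℂ).mulVec (u s y')) y :=
    fun s y => by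
      rw [(helper_hasDerivAt a _ _ s (d1 s y)).deriv, (helper_hasDerivAt 1 _ _ y (d2 s y)).deriv]
      exact helper_alg1 a (A s y) ha_herm ha_sq (hA_herm s y) (hA_comm s y) _ _ _ (hu_eq s y)
  have c2 : ∀ s y, deriv (fun y' => star (u s y') ⬝ᵥ a.mulVec (u s y')) y
      = deriv (fun s' => star (u s' y) ⬝ᵥ (1 : Matrix (Fin 2) (Fin 2) ℂ).mulVec (u s' y)) s :=
    fun s y => by
      rw [(helper_hasDerivAt a _ _ y (d2 s y)).deriv, (helper_hasDerivAt 1 _ _ s (d1 s y)).deriv]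
      exact (helper_alg2 a (A s y) ha_herm (hA_herm s y) _ _ _ (hu_eq s y)).symm
  simp only [c1, c2]
  have hR : ContDiff ℝ 2 (fun p : ℝ × ℝ =>
      star (u p.1 p.2) ⬝ᵥ (1 : Matrix (Fin 2) (Fin 2) ℂ).mulVec (u p.1 p.2)) := by
    have hc := contDiff_pi.1 hu_smooth
    have hk : ∀ i, ContDiff ℝ 2 (fun p : ℝ × ℝ => star (u p.1 p.2 i)) := fun i =>
      (starL' ℝ : ℂ ≃L[ℝ] ℂ).contDiff.comp (hc i)
    simp only [one_mulVec, dotProduct, Pi.star_apply]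
    exact ContDiff.sum fun i _ => (hk i).mul (hc i)
  exact sub_eq_zero.2 (helper_symm _ hR t x)
end

section
/- Let 𝔲 be a twice continuously differentiable solution of the generalized massless Dirac/Thirring equation ∂ₜ𝔲 − 𝔞 ∂ₓ𝔲 = −i A(t,x) 𝔲 on ℝ × ℝ. Then for all t ≥ 0 and x ∈ ℝ one has the d'Alembert representation |𝔲(t,x)|² = ½[ |𝔲(0,x+t)|² + (𝔲†𝔞𝔲)(0,x+t) ] + ½[ |𝔲(0,x−t)|² − (𝔲†𝔞𝔲)(0,x−t) ]; in particular |𝔲(t,x)|² is determined by the initial data 𝔲(0,·) alone. -/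
open Matrix

theorem char_const
    (a M : Matrix (Fin 2) (Fin 2) ℂ) (ε : ℝ)
    (hM : Mᴴ = M) (hMa : M * a = (ε : ℂ) • M)
    (A : ℝ → ℝ → Matrix (Fin 2) (Fin 2) ℂ)
    (hA_herm : ∀ t x, (A t x)ᴴ = A t x)
    (hA_comm : ∀ t x, M * A t x = A t x * M)
    (u : ℝ → ℝ → Fin 2 → ℂ)
    (hu_smooth : ContDiff ℝ 2 (fun p : ℝ × ℝ => u p.1 p.2))
    (hu_eq : ∀ t x : ℝ,
      deriv (fun s => u s x) t - a.mulVec (deriv (fun y => u t y) x)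
        = -(Complex.I • (A t x).mulVec (u t x))) (t x : ℝ) :
    star (u t x) ⬝ᵥ M.mulVec (u t x)
      = star (u 0 (x + ε * t)) ⬝ᵥ M.mulVec (u 0 (x + ε * t)) := by
  have hd : Differentiable ℝ (fun p : ℝ × ℝ => u p.1 p.2) :=
    hu_smooth.differentiable (by norm_num)
  let w : ℝ → Fin 2 → ℂ := fun s => u s (x + ε * (t - s))
  have hw : ∀ s, ∃ w' : Fin 2 → ℂ, HasDerivAt w w' s ∧
      M.mulVec w' = -(Complex.I • (M * A s (x + ε * (t - s))).mulVec (w s)) := by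
    intro s
    set y := x + ε * (t - s) with hy
    have hF := (hd (s, y)).hasFDerivAt
    set L := fderiv ℝ (fun p : ℝ × ℝ => u p.1 p.2) (s, y) with hL
    have h1 : HasDerivAt (fun r => u r y) (L (1, 0)) s :=
      hF.comp_hasDerivAt (f := fun r : ℝ => (r, y)) s
        ((hasDerivAt_id s).prodMk (hasDerivAt_const s y))
    have h2 : HasDerivAt (fun z => u s z) (L (0, 1)) y :=
      hF.comp_hasDerivAt (f := fun r : ℝ => (s, r)) y
        ((hasDerivAt_const y s).prodMk (hasDerivAt_id y))
    have hl : HasDerivAt (fun r : ℝ => x + ε * (t - r)) (-ε) s := by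
      have := (((hasDerivAt_id s).const_sub t).const_mul ε).const_add x
      simpa using this
    have h3 : HasDerivAt w (L (1, -ε)) s :=
      hF.comp_hasDerivAt (f := fun r : ℝ => (r, x + ε * (t - r))) s
        ((hasDerivAt_id s).prodMk hl)
    refine ⟨_, h3, ?_⟩
    have e : ((1 : ℝ), -ε) = (1, 0) + (-ε) • ((0 : ℝ), (1 : ℝ)) := by simp
    have hq := hu_eq s y
    rw [h1.deriv, h2.deriv] at hq
    have hq' : L (1, 0) = a.mulVec (L (0, 1)) - Complex.I • (A s y).mulVec (u s y) := by
      rw [sub_eq_iff_eq_add] at hq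
      rw [hq]; abel
    have e2 : (-ε) • L (0, 1) = (-(ε : ℂ)) • L (0, 1) := by
      ext i; simp
    rw [e, map_add, map_smul, hq', e2, mulVec_add, mulVec_sub, mulVec_smul, mulVec_smul,
      mulVec_mulVec, mulVec_mulVec, hMa, smul_mulVec, neg_smul]
    abel
  have hQ : ∀ s, HasDerivAt (fun s => star (w s) ⬝ᵥ M.mulVec (w s)) 0 s := by
    intro s
    obtain ⟨w', h, hMw⟩ := hw s
    have hm : HasDerivAt (fun s => M.mulVec (w s)) (M.mulVec w') s :=
      (((M.mulVecLin.restrictScalars ℝ).toContinuousLinearMap).hasFDerivAt).comp_hasDerivAt s h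
    have key : HasDerivAt (fun s => star (w s) ⬝ᵥ M.mulVec (w s))
        (∑ i, (star (w' i) * (M.mulVec (w s)) i + star (w s i) * (M.mulVec w') i)) s := by
      unfold dotProduct
      exact HasDerivAt.fun_sum fun i _ =>
        ((hasDerivAt_pi.1 h i).star).mul (hasDerivAt_pi.1 hm i)
    convert key using 1
    rw [Finset.sum_add_distrib]
    change 0 = star w' ⬝ᵥ M.mulVec (w s) + star (w s) ⬝ᵥ M.mulVec w'
    have hs : star w' ⬝ᵥ M.mulVec (w s) = star (M.mulVec w') ⬝ᵥ w s := by
      rw [star_mulVec, hM, dotProduct_mulVec]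
    rw [hs, hMw, star_neg, star_smul, star_mulVec, conjTranspose_mul, hM, hA_herm, ← hA_comm]
    rw [neg_dotProduct, smul_dotProduct, dotProduct_neg, dotProduct_smul, dotProduct_mulVec]
    simp
  have hc := is_const_of_deriv_eq_zero (fun s => (hQ s).differentiableAt)
    (fun s => (hQ s).deriv) t 0
  simpa [w] using hc

/-- d'Alembert representation for `|𝔲|²`:
`|𝔲(t,x)|² = ½[|𝔲(0,x+t)|² + (𝔲†𝔞𝔲)(0,x+t)] + ½[|𝔲(0,x−t)|² − (𝔲†𝔞𝔲)(0,x−t)]`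
for all t ≥ 0; in particular `|𝔲|²` is determined by the initial data alone. -/
theorem dAlembert_representation_modulus
    (a : Matrix (Fin 2) (Fin 2) ℂ)
    (ha_herm : aᴴ = a) (ha_sq : a * a = 1)
    (A : ℝ → ℝ → Matrix (Fin 2) (Fin 2) ℂ)
    (hA_cont : Continuous (fun p : ℝ × ℝ => A p.1 p.2))
    (hA_herm : ∀ t x, (A t x)ᴴ = A t x)
    (hA_comm : ∀ t x, a * A t x = A t x * a)
    (u : ℝ → ℝ → Fin 2 → ℂ)
    (hu_smooth : ContDiff ℝ 2 (fun p : ℝ × ℝ => u p.1 p.2))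
    (hu_eq : ∀ t x : ℝ,
      deriv (fun s => u s x) t - a.mulVec (deriv (fun y => u t y) x)
        = -(Complex.I • (A t x).mulVec (u t x))) :
    ∀ t x : ℝ, 0 ≤ t →
      star (u t x) ⬝ᵥ u t x
        = (1/2 : ℂ) * (star (u 0 (x + t)) ⬝ᵥ u 0 (x + t)
              + star (u 0 (x + t)) ⬝ᵥ a.mulVec (u 0 (x + t)))
          + (1/2 : ℂ) * (star (u 0 (x - t)) ⬝ᵥ u 0 (x - t)
              - star (u 0 (x - t)) ⬝ᵥ a.mulVec (u 0 (x - t))) := by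
  intro t x _
  have hp := char_const a (1 + a) 1 (by simp [ha_herm])
    (by rw [add_mul, ha_sq]; simp [add_comm]) A hA_herm
    (fun t x => by rw [add_mul, mul_add, hA_comm]; simp) u hu_smooth hu_eq t x
  have hm := char_const a (1 - a) (-1) (by simp [ha_herm])
    (by rw [sub_mul, ha_sq]; simp) A hA_herm
    (fun t x => by rw [sub_mul, mul_sub, hA_comm]; simp) u hu_smooth hu_eq t x
  simp only [add_mulVec, sub_mulVec, one_mulVec, dotProduct_add, dotProduct_sub, one_mul,
    neg_mul, ← sub_eq_add_neg] at hp hm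
  rw [← hp, ← hm]
  ring
end

section
/- Let 𝔲 be a twice continuously differentiable solution of the generalized massless Dirac/Thirring equation ∂ₜ𝔲 − 𝔞 ∂ₓ𝔲 = −i A(t,x) 𝔲 on ℝ × ℝ. Then for all t ≥ 0 and x ∈ ℝ one has the d'Alembert representation (𝔲†𝔞𝔲)(t,x) = ½[ |𝔲(0,x+t)|² + (𝔲†𝔞𝔲)(0,x+t) ] − ½[ |𝔲(0,x−t)|² − (𝔲†𝔞𝔲)(0,x−t) ]. -/
open Matrix

lemma hasDerivAt_dot {v w : ℝ → Fin 2 → ℂ} {v' w' : Fin 2 → ℂ} {s : ℝ}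
    (hv : HasDerivAt v v' s) (hw : HasDerivAt w w' s) :
    HasDerivAt (fun r => star (v r) ⬝ᵥ w r) (star v' ⬝ᵥ w s + star (v s) ⬝ᵥ w') s := by
  rw [hasDerivAt_pi] at hv hw
  have h := ((hv 0).star.mul (hw 0)).add ((hv 1).star.mul (hw 1))
  have e1 : (fun r => star (v r) ⬝ᵥ w r) =
      ((fun x => star (v x 0)) * fun x => w x 0) + (fun x => star (v x 1)) * fun x => w x 1 := by
    funext r
    simp [dotProduct, Fin.sum_univ_two]
  have e2 : star v' ⬝ᵥ w s + star (v s) ⬝ᵥ w' =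
      star (v' 0) * w s 0 + star (v s 0) * w' 0 + (star (v' 1) * w s 1 + star (v s 1) * w' 1) := by
    simp only [dotProduct, Fin.sum_univ_two, Pi.star_apply]
    ring
  rw [e1, e2]
  exact h

lemma hasDerivAt_mulVec (B : Matrix (Fin 2) (Fin 2) ℂ) {v : ℝ → Fin 2 → ℂ} {v' : Fin 2 → ℂ} {s : ℝ}
    (hv : HasDerivAt v v' s) : HasDerivAt (fun r => B *ᵥ v r) (B *ᵥ v') s := by
  rw [hasDerivAt_pi] at hv ⊢
  intro i
  have h := ((hv 0).const_mul (B i 0)).add ((hv 1).const_mul (B i 1))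
  convert h using 1
  · funext r
    simp [mulVec, dotProduct, Fin.sum_univ_two]
  · simp [mulVec, dotProduct, Fin.sum_univ_two]

lemma transport
    (a : Matrix (Fin 2) (Fin 2) ℂ)
    (ha_herm : aᴴ = a) (ha_sq : a * a = 1)
    (A : ℝ → ℝ → Matrix (Fin 2) (Fin 2) ℂ)
    (hA_herm : ∀ t x, (A t x)ᴴ = A t x)
    (hA_comm : ∀ t x, a * A t x = A t x * a)
    (u : ℝ → ℝ → Fin 2 → ℂ)
    (hu_smooth : ContDiff ℝ 2 (fun p : ℝ × ℝ => u p.1 p.2))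
    (hu_eq : ∀ t x : ℝ,
      deriv (fun s => u s x) t - a.mulVec (deriv (fun y => u t y) x)
        = -(Complex.I • (A t x).mulVec (u t x)))
    (e : ℝ) (he : e * e = 1) (t x : ℝ) :
    star (u t x) ⬝ᵥ (1 + (e : ℂ) • a) *ᵥ u t x
      = star (u 0 (x + e * t)) ⬝ᵥ (1 + (e : ℂ) • a) *ᵥ u 0 (x + e * t) := by
  have heC : (e : ℂ) * e = 1 := by exact_mod_cast he
  set B : Matrix (Fin 2) (Fin 2) ℂ := 1 + (e : ℂ) • a with hB
  have hBherm : Bᴴ = B := by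
    simp [hB, ha_herm]
  have hBA : ∀ t x, B * A t x = A t x * B := by
    intro t x
    simp [hB, add_mul, mul_add, hA_comm]
  have hBa : B * a = (e : ℂ) • B := by
    rw [hB, add_mul, one_mul, smul_mul_assoc, ha_sq, smul_add, smul_smul, heC, one_smul, add_comm]
  set c := x + e * t with hc
  let v : ℝ → Fin 2 → ℂ := fun s => u s (c - e * s)
  have key : ∀ s, HasDerivAt (fun r => star (v r) ⬝ᵥ B *ᵥ v r) 0 s := by
    intro s
    set y := c - e * s with hy
    have hF := ((hu_smooth.differentiable (by norm_num)) (s, y)).hasFDerivAt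
    set L := fderiv ℝ (fun p : ℝ × ℝ => u p.1 p.2) (s, y) with hL
    have h1 : HasDerivAt (fun r => u r y) (L (1, 0)) s :=
      HasFDerivAt.comp_hasDerivAt (f := fun r : ℝ => (r, y)) s hF
        ((hasDerivAt_id s).prodMk (hasDerivAt_const s y))
    have h2 : HasDerivAt (fun r => u s r) (L (0, 1)) y :=
      HasFDerivAt.comp_hasDerivAt (f := fun r : ℝ => (s, r)) y hF
        ((hasDerivAt_const y s).prodMk (hasDerivAt_id y))
    have h3 : HasDerivAt v (L (1, -e)) s := by
      refine HasFDerivAt.comp_hasDerivAt (f := fun r : ℝ => (r, c - e * r)) s hF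
        ((hasDerivAt_id s).prodMk ?_)
      simpa using ((hasDerivAt_id s).const_mul e).const_sub c
    have hLe : L (1, -e) = L (1, 0) - (e : ℂ) • L (0, 1) := by
      have : ((1 : ℝ), -e) = (1, 0) - e • ((0 : ℝ), (1 : ℝ)) := by simp
      rw [this, map_sub, map_smul]
      rfl
    have heq := hu_eq s y
    rw [h1.deriv, h2.deriv] at heq
    have hBv : B *ᵥ L (1, -e) = -(Complex.I • (B * A s y) *ᵥ v s) := by
      have h4 := congrArg (fun w => B *ᵥ w) heq
      simp only [mulVec_sub, mulVec_neg, mulVec_smul, mulVec_mulVec, hBa, smul_mulVec] at h4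
      rw [hLe, mulVec_sub, mulVec_smul, h4]
    have hd := hasDerivAt_dot h3 (hasDerivAt_mulVec B h3)
    refine hd.congr_deriv ?_
    have h5 : star (L (1, -e)) ⬝ᵥ B *ᵥ v s = star (B *ᵥ L (1, -e)) ⬝ᵥ v s := by
      rw [star_mulVec, hBherm, dotProduct_mulVec]
    have h6 : star ((B * A s y) *ᵥ v s) ⬝ᵥ v s = star (v s) ⬝ᵥ (B * A s y) *ᵥ v s := by
      rw [star_mulVec, conjTranspose_mul, hBherm, hA_herm, ← hBA, dotProduct_mulVec]
    rw [h5, hBv]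
    rw [star_neg, star_smul, neg_dotProduct, smul_dotProduct, dotProduct_neg, dotProduct_smul, h6]
    simp only [smul_eq_mul, Complex.star_def, Complex.conj_I]
    ring
  have hconst := is_const_of_deriv_eq_zero (fun s => (key s).differentiableAt)
    (fun s => (key s).deriv) t 0
  simpa [v, hc] using hconst

/-- d'Alembert representation for `𝔲†𝔞𝔲`:
`(𝔲†𝔞𝔲)(t,x) = ½[|𝔲(0,x+t)|² + (𝔲†𝔞𝔲)(0,x+t)] − ½[|𝔲(0,x−t)|² − (𝔲†𝔞𝔲)(0,x−t)]`
for all t ≥ 0. -/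
theorem dAlembert_representation_dagger_a
    (a : Matrix (Fin 2) (Fin 2) ℂ)
    (ha_herm : aᴴ = a) (ha_sq : a * a = 1)
    (A : ℝ → ℝ → Matrix (Fin 2) (Fin 2) ℂ)
    (hA_cont : Continuous (fun p : ℝ × ℝ => A p.1 p.2))
    (hA_herm : ∀ t x, (A t x)ᴴ = A t x)
    (hA_comm : ∀ t x, a * A t x = A t x * a)
    (u : ℝ → ℝ → Fin 2 → ℂ)
    (hu_smooth : ContDiff ℝ 2 (fun p : ℝ × ℝ => u p.1 p.2))
    (hu_eq : ∀ t x : ℝ,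
      deriv (fun s => u s x) t - a.mulVec (deriv (fun y => u t y) x)
        = -(Complex.I • (A t x).mulVec (u t x))) :
    ∀ t x : ℝ, 0 ≤ t →
      star (u t x) ⬝ᵥ a.mulVec (u t x)
        = (1/2 : ℂ) * (star (u 0 (x + t)) ⬝ᵥ u 0 (x + t)
              + star (u 0 (x + t)) ⬝ᵥ a.mulVec (u 0 (x + t)))
          - (1/2 : ℂ) * (star (u 0 (x - t)) ⬝ᵥ u 0 (x - t)
              - star (u 0 (x - t)) ⬝ᵥ a.mulVec (u 0 (x - t))) := by
  intro t x _
  have hp := transport a ha_herm ha_sq A hA_herm hA_comm u hu_smooth hu_eq 1 (by norm_num) t x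
  have hm := transport a ha_herm ha_sq A hA_herm hA_comm u hu_smooth hu_eq (-1) (by norm_num) t x
  simp only [Complex.ofReal_one, Complex.ofReal_neg, one_smul, neg_smul, one_mul, neg_mul,
    add_mulVec, neg_mulVec, one_mulVec, dotProduct_add, dotProduct_neg] at hp hm
  rw [← sub_eq_add_neg x t] at hm
  linear_combination (1/2 : ℂ) * hp - (1/2 : ℂ) * hm
end

section
/- Let 𝔲 be a twice continuously differentiable solution of the generalized massless Dirac/Thirring equation ∂ₜ𝔲 − 𝔞 ∂ₓ𝔲 = −i A(t,x) 𝔲 on ℝ × ℝ. If the initial data satisfies |𝔲(0,x)|² + (𝔲†𝔞𝔲)(0,x) > 0 for every x ∈ ℝ, then |𝔲(t,x)|² > 0 for every t ≥ 0 and x ∈ ℝ. -/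
open Matrix

/-- If the initial data satisfies `|𝔲(0,x)|² + (𝔲†𝔞𝔲)(0,x) > 0` for every
`x`, then `|𝔲(t,x)|² > 0` for every `t ≥ 0` and every `x`. -/
theorem positivity_of_modulus
    (a : Matrix (Fin 2) (Fin 2) ℂ)
    (ha_herm : aᴴ = a) (ha_sq : a * a = 1)
    (A : ℝ → ℝ → Matrix (Fin 2) (Fin 2) ℂ)
    (hA_cont : Continuous (fun p : ℝ × ℝ => A p.1 p.2))
    (hA_herm : ∀ t x, (A t x)ᴴ = A t x)
    (hA_comm : ∀ t x, a * A t x = A t x * a)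
    (u : ℝ → ℝ → Fin 2 → ℂ)
    (hu_smooth : ContDiff ℝ 2 (fun p : ℝ × ℝ => u p.1 p.2))
    (hu_eq : ∀ t x : ℝ,
      deriv (fun s => u s x) t - a.mulVec (deriv (fun y => u t y) x)
        = -(Complex.I • (A t x).mulVec (u t x)))
    (h_init : ∀ x : ℝ,
      0 < (star (u 0 x) ⬝ᵥ u 0 x + star (u 0 x) ⬝ᵥ a.mulVec (u 0 x)).re) :
    ∀ t x : ℝ, 0 ≤ t → 0 < (star (u t x) ⬝ᵥ u t x).re := by
  intro t x _
  set c : ℝ := x + t with hc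
  have hdiff : Differentiable ℝ (fun p : ℝ × ℝ => u p.1 p.2) :=
    hu_smooth.differentiable (by norm_num)
  -- derivative of `u` along the characteristic
  have hg : ∀ s : ℝ, HasDerivAt (fun s : ℝ => u s (c - s))
      (deriv (fun r => u r (c - s)) s - deriv (fun y => u s y) (c - s)) s := by
    intro s
    have hF := (hdiff (s, c - s)).hasFDerivAt
    have h1 : HasDerivAt (fun r : ℝ => u r (c - s)) _ s :=
      HasFDerivAt.comp_hasDerivAt (f := fun r : ℝ => (r, c - s)) s hF
        ((hasDerivAt_id s).prodMk (hasDerivAt_const s (c - s)))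
    have h2 : HasDerivAt (fun y : ℝ => u s y) _ (c - s) :=
      HasFDerivAt.comp_hasDerivAt (f := fun y : ℝ => (s, y)) (c - s) hF
        ((hasDerivAt_const (c - s) s).prodMk (hasDerivAt_id (c - s)))
    have h3 : HasDerivAt (fun r : ℝ => u r (c - r)) _ s :=
      HasFDerivAt.comp_hasDerivAt (f := fun r : ℝ => (r, c - r)) s hF
        ((hasDerivAt_id s).prodMk ((hasDerivAt_id s).const_sub c))
    rw [h1.deriv, h2.deriv, ← map_sub]
    simpa using h3
  let w : ℝ → Fin 2 → ℂ := fun s => (1 + a).mulVec (u s (c - s))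
  have hw : ∀ s : ℝ, HasDerivAt w (-(Complex.I • (A s (c - s)).mulVec (w s))) s := by
    intro s
    have h := hg s
    have key : (1 + a).mulVec (deriv (fun r => u r (c - s)) s - deriv (fun y => u s y) (c - s))
        = -(Complex.I • (A s (c - s)).mulVec (w s)) := by
      have e : (1 + a) * A s (c - s) = A s (c - s) * (1 + a) := by
        rw [add_mul, mul_add, hA_comm, one_mul, mul_one]
      have e2 : (1 + a) * a = 1 + a := by
        rw [add_mul, ha_sq, one_mul, add_comm]
      have h4 := congrArg ((1 + a).mulVec) (hu_eq s (c - s))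
      rw [Matrix.mulVec_sub, Matrix.mulVec_mulVec, e2, ← Matrix.mulVec_sub, Matrix.mulVec_neg,
        Matrix.mulVec_smul, Matrix.mulVec_mulVec, e, ← Matrix.mulVec_mulVec] at h4
      exact h4
    rw [← key]
    rw [hasDerivAt_pi] at h ⊢
    intro i
    simp only [w, Matrix.mulVec, dotProduct]
    exact HasDerivAt.fun_sum fun j _ => (h j).const_mul _
  let N : ℝ → ℂ := fun s => star (w s) ⬝ᵥ w s
  have hN : ∀ s : ℝ, HasDerivAt N 0 s := by
    intro s
    have h := hasDerivAt_pi.1 (hw s)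
    have h5 : HasDerivAt N (∑ i, (star ((-(Complex.I • (A s (c - s)).mulVec (w s))) i) * w s i
        + star (w s i) * (-(Complex.I • (A s (c - s)).mulVec (w s))) i)) s :=
      HasDerivAt.fun_sum fun i _ => (h i).star.mul (h i)
    convert h5 using 1
    have h6 : star ((A s (c - s)).mulVec (w s)) ⬝ᵥ w s
        = star (w s) ⬝ᵥ (A s (c - s)).mulVec (w s) := by
      rw [Matrix.star_mulVec, hA_herm, ← Matrix.dotProduct_mulVec]
    have h7 : (∑ i, (star ((-(Complex.I • (A s (c - s)).mulVec (w s))) i) * w s i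
        + star (w s i) * (-(Complex.I • (A s (c - s)).mulVec (w s))) i))
        = Complex.I * (star ((A s (c - s)).mulVec (w s)) ⬝ᵥ w s)
          - Complex.I * (star (w s) ⬝ᵥ (A s (c - s)).mulVec (w s)) := by
      generalize (A s (c - s)).mulVec (w s) = z
      simp [dotProduct, Fin.sum_univ_two]
      ring
    rw [h7, h6, sub_self]
  have hconst : N t = N 0 :=
    is_const_of_deriv_eq_zero (fun s => (hN s).differentiableAt) (fun s => (hN s).deriv) t 0
  have hne : u t x ≠ 0 := by
    intro h0
    have hct : c - t = x := by simp [hc]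
    have hNt : N t = 0 := by simp [N, w, hct, h0]
    have hw0 : w 0 = 0 := by
      rw [hNt] at hconst
      open ComplexOrder in exact dotProduct_star_self_eq_zero.1 hconst.symm
    have hi := h_init (c - 0)
    rw [← dotProduct_add] at hi
    have : u 0 (c - 0) + a.mulVec (u 0 (c - 0)) = 0 := by
      rw [← hw0]; simp [w, Matrix.add_mulVec]
    rw [this] at hi
    simp at hi
  obtain ⟨i, hi⟩ := Function.ne_iff.1 hne
  have hsum : (star (u t x) ⬝ᵥ u t x).re = ∑ j, Complex.normSq (u t x j) := by
    simp [dotProduct, Fin.sum_univ_two, Complex.normSq_apply]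
  rw [hsum]
  exact Finset.sum_pos' (fun j _ => Complex.normSq_nonneg _)
    ⟨i, Finset.mem_univ i, Complex.normSq_pos.2 hi⟩
end

section
/- Maximum principle for the viscous approximation: Let c₀ > 0, 0 < M < c₀, α > 0, ε ∈ (0,1), T > 0. Let f, h : [0,T] × ℝ → ℝ be C², with h(t,(1−ε)c₀) > 0 and h(t,−(1−ε)c₀) < 0 for all t ∈ [0,T]. Let g ∈ C³(ℝ) with g'(v) = 0 whenever |v| ≥ M. Let w : [0,T] × ℝ → ℝ be a nonnegative C¹ function such that w and ∂ₓw are bounded. Suppose v : [0,T] × ℝ → ℝ is a bounded classical solution (C¹ in t, C² in x, with ∂ₓv bounded) of the viscous equation ∂ₜv + ∂ₓ( f(t,v) ) + h(t,(1−ε)v) = α ∂ₓ( g'(v) w ) + ε ∂ₓₓ v on (0,T] × ℝ, satisfying |v(0,x)| ≤ c₀ for all x ∈ ℝ. Then |v(t,x)| ≤ c₀ for all (t,x) ∈ [0,T] × ℝ. -/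
open Set

theorem second_deriv_nonpos_of_max (p : ℝ → ℝ) (x : ℝ) (hp : ContDiff ℝ 2 p)
    (hx : IsLocalMax p x) : deriv (deriv p) x ≤ 0 := by
  by_contra hcon
  push Not at hcon
  have h1 := isLocalMin_of_deriv_deriv_pos hcon hx.deriv_eq_zero hp.continuous.continuousAt
  have h2 : p =ᶠ[nhds x] fun _ => p x := by
    filter_upwards [h1, hx] with y a b using le_antisymm b a
  have h3 : deriv p =ᶠ[nhds x] deriv (fun _ => p x) := h2.deriv
  have h4 := h3.deriv_eq
  simp at h4
  linarith

theorem deriv_nonneg_of_left_max (p : ℝ → ℝ) (t p' : ℝ) (ht : 0 < t) (hp : HasDerivAt p p' t)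
    (hx : ∀ s ∈ Icc 0 t, p s ≤ p t) : 0 ≤ p' := by
  have h1 := hp.hasDerivWithinAt (s := Iio t)
  rw [hasDerivWithinAt_iff_tendsto_slope' (by simp)] at h1
  refine ge_of_tendsto h1 ?_
  filter_upwards [Ioo_mem_nhdsLT ht] with s hs
  rw [slope_def_field]
  exact div_nonneg_of_nonpos (by linarith [hx s ⟨hs.1.le, hs.2.le⟩]) (by linarith [hs.2])

set_option maxHeartbeats 2000000 in
theorem one_sided_max (c ε B L C T : ℝ) (hε : ε ∈ Ioo (0:ℝ) 1) (hB : 0 ≤ B) (hL : 0 ≤ L)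
    (v : ℝ → ℝ → ℝ)
    (hC : ∀ t x, v t x ≤ C)
    (hv_cont : Continuous (fun p : ℝ × ℝ => v p.1 p.2))
    (hv_t : ∀ x : ℝ, ContDiff ℝ 1 (fun t => v t x))
    (hv_x : ∀ t : ℝ, ContDiff ℝ 2 (fun x => v t x))
    (hv_eq : ∀ t ∈ Ioc (0:ℝ) T, ∀ x : ℝ, c < v t x →
      deriv (fun s => v s x) t ≤ ε * deriv (deriv (v t)) x + B * |deriv (v t) x|
        + L * (v t x - c))
    (hv_init : ∀ x : ℝ, v 0 x ≤ c) :
    ∀ t ∈ Icc (0:ℝ) T, ∀ x : ℝ, v t x ≤ c := by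
  intro t₁ ht₁ x₁
  by_contra hcon
  push Not at hcon
  set K := 2 + B + L with hK
  have hT : 0 ≤ T := ht₁.1.trans ht₁.2
  set a := Real.exp (-K * t₁) * (v t₁ x₁ - c) with ha
  have hapos : 0 < a := mul_pos (Real.exp_pos _) (by linarith)
  set δ := a / (2 * (1 + x₁^2)) with hδ
  have hδpos : 0 < δ := by positivity
  set z : ℝ → ℝ → ℝ := fun t x => Real.exp (-K * t) * (v t x - c) - δ * (1 + x^2) with hz
  have hz1 : 0 < z t₁ x₁ := by
    have : δ * (1 + x₁^2) = a / 2 := by rw [hδ]; field_simp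
    simp only [hz]; rw [this]; linarith
  have hCc : 0 < C - c := by linarith [hC t₁ x₁]
  set R := |x₁| + (C - c) / δ + 1 with hR
  have hdp : 0 < (C - c) / δ := by positivity
  have hR1 : 1 ≤ R := by linarith [abs_nonneg x₁]
  have hcomp : IsCompact (Icc (0:ℝ) T ×ˢ Icc (-R) R) := isCompact_Icc.prod isCompact_Icc
  have hzc : Continuous (fun p : ℝ × ℝ => z p.1 p.2) := by
    simp only [hz]; fun_prop
  have hx₁ : x₁ ∈ Icc (-R) R := by
    rw [mem_Icc, ← abs_le]; linarith
  obtain ⟨⟨t, x⟩, hm, hmax⟩ := hcomp.exists_isMaxOn ⟨(t₁, x₁), ht₁, hx₁⟩ hzc.continuousOn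
  have hmax' : ∀ s ∈ Icc (0:ℝ) T, ∀ y ∈ Icc (-R) R, z s y ≤ z t x := fun s hs y hy =>
    hmax (a := (s, y)) ⟨hs, hy⟩
  have hzpos : 0 < z t x := hz1.trans_le (hmax' _ ht₁ _ hx₁)
  obtain ⟨htm, hxm⟩ := hm
  simp only at htm hxm
  have hE : 0 < Real.exp (-K * t) := Real.exp_pos _
  have hE1 : Real.exp (-K * t) ≤ 1 := Real.exp_le_one_iff.2 (by nlinarith [htm.1])
  have hzdef : z t x = Real.exp (-K * t) * (v t x - c) - δ * (1 + x^2) := rfl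
  have hu' : 0 < Real.exp (-K * t) * (v t x - c) := by nlinarith [sq_nonneg x]
  have hu : 0 < v t x - c := (mul_pos_iff_of_pos_left hE).1 hu'
  have ht0 : 0 < t := by
    rcases htm.1.lt_or_eq with h | h
    · exact h
    · rw [← h] at hu; linarith [hv_init x]
  -- interior in x
  have hxR : |x| < R := by
    by_contra hge
    push Not at hge
    have h1 : R ≤ x^2 := by rw [← sq_abs]; nlinarith
    have h2 : C - c < δ * R := by
      have : δ * ((C - c) / δ) = C - c := by field_simp
      rw [hR]; nlinarith [abs_nonneg x₁]
    have h3 : Real.exp (-K * t) * (v t x - c) ≤ C - c := by nlinarith [hC t x]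
    nlinarith
  rw [abs_lt] at hxR
  have hloc : IsLocalMax (z t) x := by
    filter_upwards [Ioo_mem_nhds hxR.1 hxR.2] with y hy
    exact hmax' t htm y ⟨hy.1.le, hy.2.le⟩
  have hvd : Differentiable ℝ (v t) := (hv_x t).differentiable (by norm_num)
  have hzx : ContDiff ℝ 2 (z t) := by
    have := hv_x t
    simp only [hz]; fun_prop
  have hd1 : ∀ y, HasDerivAt (z t) (Real.exp (-K * t) * deriv (v t) y - δ * (2 * y)) y := by
    intro y
    have h1 := (((hvd y).hasDerivAt.sub_const c).const_mul (Real.exp (-K * t))).sub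
      (((hasDerivAt_pow 2 y).const_add 1).const_mul δ)
    exact HasDerivAt.congr_deriv (f := z t) h1 (by norm_num)
  have hd1' : deriv (z t) = fun y => Real.exp (-K * t) * deriv (v t) y - δ * (2 * y) :=
    funext fun y => (hd1 y).deriv
  have hvdd : Differentiable ℝ (deriv (v t)) := by
    have h2 : ContDiff ℝ (1 + 1) (v t) := by norm_num; exact hv_x t
    exact (contDiff_succ_iff_deriv.1 h2).2.2.differentiable (by norm_num)
  have hd2 : deriv (deriv (z t)) x = Real.exp (-K * t) * deriv (deriv (v t)) x - δ * 2 := by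
    rw [hd1']
    have h1 := ((hvdd x).hasDerivAt.const_mul (Real.exp (-K * t))).sub
      (((hasDerivAt_id x).const_mul 2).const_mul δ)
    have := h1.deriv
    simp only [mul_one] at this
    exact this
  have hxx := second_deriv_nonpos_of_max _ _ hzx hloc
  rw [hd2] at hxx
  have hx0 := hloc.deriv_eq_zero
  rw [(hd1 x).deriv] at hx0
  have hvt : HasDerivAt (fun s => v s x) (deriv (fun s => v s x) t) t :=
    (((hv_t x).differentiable (by norm_num)) t).hasDerivAt
  have htd : HasDerivAt (fun s => z s x)
      (Real.exp (-K * t) * (deriv (fun s => v s x) t - K * (v t x - c))) t := by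
    have h1 := ((((hasDerivAt_id t).const_mul (-K)).exp.mul (hvt.sub_const c))).sub_const
      (δ * (1 + x^2))
    exact HasDerivAt.congr_deriv (f := fun s => z s x) h1 (by simp only [id]; ring)
  have htt := deriv_nonneg_of_left_max _ t _ ht0 htd
    (fun s hs => hmax' s ⟨hs.1, hs.2.trans htm.2⟩ x hxm)
  have hineq := hv_eq t ⟨ht0, htm.2⟩ x (by linarith)
  have hmul := mul_le_mul_of_nonneg_left hineq hE.le
  set E := Real.exp (-K * t)
  have hvx : E * |deriv (v t) x| ≤ δ * (1 + x^2) := by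
    have : E * |deriv (v t) x| = δ * (2 * |x|) := by
      rw [← abs_of_pos hE, ← abs_mul, show E * deriv (v t) x = δ * (2 * x) by linarith, abs_mul,
        abs_mul, abs_of_pos hδpos, abs_two]
    rw [this]
    have h := sq_nonneg (|x| - 1)
    have h' := sq_abs x
    exact mul_le_mul_of_nonneg_left (by nlinarith) hδpos.le
  have hvx' : B * (E * |deriv (v t) x|) ≤ B * (E * (v t x - c)) :=
    mul_le_mul_of_nonneg_left (by linarith) hB
  have hvxx : ε * (E * deriv (deriv (v t)) x) ≤ ε * (δ * 2) :=
    mul_le_mul_of_nonneg_left (by linarith) hε.1.le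
  have h5 : ε * (δ * 2) < δ * 2 := by nlinarith [hε.2]
  have h6 : δ ≤ δ * (1 + x^2) := by nlinarith [sq_nonneg x]
  have h7 : E * (ε * deriv (deriv (v t)) x + B * |deriv (v t) x| + L * (v t x - c))
      = ε * (E * deriv (deriv (v t)) x) + B * (E * |deriv (v t) x|) + L * (E * (v t x - c)) := by
    ring
  have h8 : E * (deriv (fun s => v s x) t - K * (v t x - c))
      = E * deriv (fun s => v s x) t - 2 * (E * (v t x - c)) - B * (E * (v t x - c))
        - L * (E * (v t x - c)) := by
    rw [hK]; ring
  rw [h7] at hmul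
  rw [h8] at htt
  linarith

theorem fderiv_bound (F : ℝ × ℝ → ℝ) (hF : ContDiff ℝ 2 F) (T C : ℝ) :
    ∃ B : ℝ, 0 ≤ B ∧ ∀ t ∈ Icc (0:ℝ) T, ∀ y ∈ Icc (-C) C, ‖fderiv ℝ F (t, y)‖ ≤ B := by
  have hcomp : IsCompact (Icc (0:ℝ) T ×ˢ Icc (-C) C) := isCompact_Icc.prod isCompact_Icc
  obtain ⟨B, hB⟩ := hcomp.exists_bound_of_continuousOn
    (hF.continuous_fderiv (by norm_num)).continuousOn
  exact ⟨max B 0, le_max_right _ _, fun t ht y hy => (hB (t, y) ⟨ht, hy⟩).trans (le_max_left _ _)⟩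

theorem hasDerivAt_slice (F : ℝ × ℝ → ℝ) (hF : ContDiff ℝ 2 F) (t : ℝ) (p : ℝ → ℝ) (x p' : ℝ)
    (hp : HasDerivAt p p' x) :
    HasDerivAt (fun y => F (t, p y)) (fderiv ℝ F (t, p x) (0, p')) x := by
  have h1 : HasFDerivAt F (fderiv ℝ F (t, p x)) (t, p x) :=
    (hF.differentiable (by norm_num) _).hasFDerivAt
  exact h1.comp_hasDerivAt x ((hasDerivAt_const x t).prodMk hp)

theorem norm_slice_le (A : ℝ × ℝ →L[ℝ] ℝ) (B p : ℝ) (hA : ‖A‖ ≤ B) : |A (0, p)| ≤ B * |p| := by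
  have h1 := A.le_opNorm (0, p)
  have h2 : ‖((0:ℝ), p)‖ = |p| := by simp [Prod.norm_def]
  rw [h2] at h1
  exact h1.trans (mul_le_mul_of_nonneg_right hA (abs_nonneg _))

theorem slice_lip (F : ℝ × ℝ → ℝ) (hF : ContDiff ℝ 2 F) (t B C : ℝ)
    (hB : ∀ y ∈ Icc (-C) C, ‖fderiv ℝ F (t, y)‖ ≤ B) (a b : ℝ) (ha : a ∈ Icc (-C) C)
    (hb : b ∈ Icc (-C) C) : |F (t, b) - F (t, a)| ≤ B * |b - a| := by
  refine (convex_Icc (-C) C).norm_image_sub_le_of_norm_hasDerivWithin_le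
    (f := fun y => F (t, y)) (f' := fun y => fderiv ℝ F (t, y) (0, 1)) ?_ ?_ ha hb
  · intro y _
    exact (hasDerivAt_slice F hF t id y 1 (hasDerivAt_id y)).hasDerivWithinAt
  · intro y hy
    simpa using norm_slice_le _ B 1 (hB y hy)

/-- Maximum principle for the viscous approximation: a bounded classical
solution of `∂ₜv + ∂ₓ(f(t,v)) + h(t,(1−ε)v) = α ∂ₓ(g'(v)w) + ε ∂ₓₓv` on `(0,T] × ℝ`
with `|v(0,·)| ≤ c₀` satisfies `|v(t,x)| ≤ c₀` on `[0,T] × ℝ`, provided `g'` vanishes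
outside `(−M,M)` with `M < c₀`, `h(t,±(1−ε)c₀)` has the right signs, and `w ≥ 0`. -/
theorem viscous_maximum_principle
    (c₀ M α ε T : ℝ)
    (hc₀ : 0 < c₀) (hM0 : 0 < M) (hMc : M < c₀) (hα : 0 < α)
    (hε : ε ∈ Set.Ioo (0:ℝ) 1) (hT : 0 < T)
    (f h : ℝ → ℝ → ℝ)
    (hf : ContDiff ℝ 2 (fun p : ℝ × ℝ => f p.1 p.2))
    (hh : ContDiff ℝ 2 (fun p : ℝ × ℝ => h p.1 p.2))
    (hh_pos : ∀ t ∈ Set.Icc (0:ℝ) T, 0 < h t ((1 - ε) * c₀))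
    (hh_neg : ∀ t ∈ Set.Icc (0:ℝ) T, h t (-((1 - ε) * c₀)) < 0)
    (g : ℝ → ℝ) (hg : ContDiff ℝ 3 g)
    (hg' : ∀ ξ : ℝ, M ≤ |ξ| → deriv g ξ = 0)
    (w : ℝ → ℝ → ℝ)
    (hw_nonneg : ∀ t x, 0 ≤ w t x)
    (hw_C1 : ContDiff ℝ 1 (fun p : ℝ × ℝ => w p.1 p.2))
    (hw_bdd : ∃ C : ℝ, ∀ t x, |w t x| ≤ C ∧ |deriv (fun y => w t y) x| ≤ C)
    (v : ℝ → ℝ → ℝ)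
    (hv_bdd : ∃ C : ℝ, ∀ t x, |v t x| ≤ C)
    (hvx_bdd : ∃ C : ℝ, ∀ t x, |deriv (fun y => v t y) x| ≤ C)
    (hv_cont : Continuous (fun p : ℝ × ℝ => v p.1 p.2))
    (hv_t : ∀ x : ℝ, ContDiff ℝ 1 (fun t => v t x))
    (hv_x : ∀ t : ℝ, ContDiff ℝ 2 (fun x => v t x))
    (hv_eq : ∀ t ∈ Set.Ioc (0:ℝ) T, ∀ x : ℝ,
      deriv (fun s => v s x) t
        + deriv (fun y => f t (v t y)) x
        + h t ((1 - ε) * v t x)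
        = α * deriv (fun y => deriv g (v t y) * w t y) x
          + ε * deriv (fun y => deriv (fun y' => v t y') y) x)
    (hv_init : ∀ x : ℝ, |v 0 x| ≤ c₀) :
    ∀ t ∈ Set.Icc (0:ℝ) T, ∀ x : ℝ, |v t x| ≤ c₀ := by
  obtain ⟨C₀, hC₀⟩ := hv_bdd
  obtain ⟨C, hC0, hCc, hC⟩ : ∃ C : ℝ, 0 ≤ C ∧ c₀ ≤ C ∧ ∀ t x, |v t x| ≤ C :=
    ⟨max C₀ c₀, hc₀.le.trans (le_max_right _ _), le_max_right _ _,
      fun t x => (hC₀ t x).trans (le_max_left _ _)⟩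
  obtain ⟨B, hB0, hB⟩ := fderiv_bound _ hf T C
  obtain ⟨L, hL0, hL⟩ := fderiv_bound _ hh T C
  have hε1 : 0 < 1 - ε := by linarith [hε.2]
  have hε2 : 1 - ε < 1 := by linarith [hε.1]
  have hscale : ∀ y, |y| ≤ C → (1 - ε) * y ∈ Icc (-C) C := by
    intro y hy
    rw [mem_Icc, ← abs_le, abs_mul, abs_of_pos hε1]
    nlinarith [abs_nonneg y]
  have hlip : ∀ t ∈ Icc (0:ℝ) T, ∀ a b, |a| ≤ C → |b| ≤ C →
      |h t ((1 - ε) * b) - h t ((1 - ε) * a)| ≤ L * |b - a| := by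
    intro t ht a b ha hb
    have := slice_lip _ hh t L C (hL t ht) _ _ (hscale a ha) (hscale b hb)
    refine this.trans (mul_le_mul_of_nonneg_left ?_ hL0)
    rw [← mul_sub, abs_mul, abs_of_pos hε1]
    nlinarith [abs_nonneg (b - a)]
  have hvd : ∀ t, Differentiable ℝ (v t) := fun t => (hv_x t).differentiable (by norm_num)
  have hfd : ∀ t ∈ Icc (0:ℝ) T, ∀ x,
      |deriv (fun y => f t (v t y)) x| ≤ B * |deriv (v t) x| := by
    intro t ht x
    rw [(hasDerivAt_slice _ hf t (v t) x _ (hvd t x).hasDerivAt).deriv]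
    exact norm_slice_le _ B _ (hB t ht _ (abs_le.1 (hC t x)))
  have hgz : ∀ t x, c₀ < |v t x| → deriv (fun y => deriv g (v t y) * w t y) x = 0 := by
    intro t x hx
    have h1 : (fun y => deriv g (v t y) * w t y) =ᶠ[nhds x] fun _ => (0:ℝ) := by
      have h2 : ∀ᶠ y in nhds x, c₀ < |v t y| :=
        (hvd t).continuous.abs.continuousAt.eventually (lt_mem_nhds hx)
      filter_upwards [h2] with y hy
      rw [hg' _ (hMc.trans hy).le, zero_mul]
    rw [h1.deriv_eq]; simp
  have hcC : |c₀| ≤ C := by rwa [abs_of_pos hc₀]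
  have hup : ∀ t ∈ Icc (0:ℝ) T, ∀ x : ℝ, v t x ≤ c₀ := by
    refine one_sided_max c₀ ε B L C T hε hB0 hL0 v (fun t x => (abs_le.1 (hC t x)).2)
      hv_cont hv_t hv_x ?_ (fun x => (abs_le.1 (hv_init x)).2)
    intro t ht x hx
    have ht' : t ∈ Icc (0:ℝ) T := ⟨ht.1.le, ht.2⟩
    have h1 := hv_eq t ht x
    rw [hgz t x (hx.trans_le (le_abs_self _))] at h1
    have h2 := (abs_le.1 (hfd t ht' x)).1
    have h3 := (abs_le.1 (hlip t ht' c₀ (v t x) hcC (hC t x))).1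
    rw [abs_of_pos (sub_pos.2 hx)] at h3
    have h4 := hh_pos t ht'
    change _ = _ + ε * deriv (deriv (v t)) x at h1
    linarith
  have hlow : ∀ t ∈ Icc (0:ℝ) T, ∀ x : ℝ, -v t x ≤ c₀ := by
    refine one_sided_max c₀ ε B L C T hε hB0 hL0 (fun t x => -v t x)
      (fun t x => neg_le.1 (abs_le.1 (hC t x)).1)
      hv_cont.neg (fun x => (hv_t x).neg) (fun t => (hv_x t).neg) ?_
      (fun x => neg_le.1 (abs_le.1 (hv_init x)).1)
    intro t ht x hx
    have ht' : t ∈ Icc (0:ℝ) T := ⟨ht.1.le, ht.2⟩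
    have h1 := hv_eq t ht x
    rw [hgz t x (hx.trans_le (neg_le_abs _))] at h1
    have h2 := (abs_le.1 (hfd t ht' x)).2
    have h3 := (abs_le.1 (hlip t ht' (-c₀) (v t x) (by rwa [abs_neg]) (hC t x))).2
    rw [abs_of_neg (by linarith)] at h3
    have h4 := hh_neg t ht'
    rw [mul_neg] at h3
    change _ = _ + ε * deriv (deriv (v t)) x at h1
    have e1 : deriv (fun y => -v t y) = fun y => -deriv (v t) y := by
      funext y; exact deriv.fun_neg
    have e2 : deriv (fun y => -deriv (v t) y) x = -deriv (deriv (v t)) x := deriv.fun_neg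
    have e3 : deriv (fun s => -v s x) t = -deriv (fun s => v s x) t := deriv.fun_neg
    rw [e1, e2, e3, abs_neg]
    linarith
  intro t ht x
  exact abs_le.2 ⟨by linarith [hlow t ht x], hup t ht x⟩
end

section
/- Entropy identity for the viscous approximation: Let α > 0, ε ∈ (0,1), T > 0, let f, h : [0,T] × ℝ → ℝ be C², let g ∈ C³(ℝ), let w : [0,T] × ℝ → ℝ be C¹, and let η ∈ C²(ℝ). If v : [0,T] × ℝ → ℝ is a C² solution of ∂ₜv + ∂ₓ( f(t,v) ) + h(t,(1−ε)v) = α ∂ₓ( g'(v) w ) + ε ∂ₓₓ v, then pointwise one has ∂ₜη(v) + ∂ₓ( ∫₀^{v(t,x)} ∂_vf(t,ξ) η'(ξ) dξ − α w(t,x) ∫₀^{v(t,x)} η'(ξ) g''(ξ) dξ ) + h(t,(1−ε)v) η'(v) = ε ∂ₓₓ( η(v) ) − ε η''(v) (∂ₓv)² + α ( η'(v) g'(v) − ∫₀^{v(t,x)} η'(ξ) g''(ξ) dξ ) ∂ₓw. -/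
open Set intervalIntegral

/-- Entropy identity for the viscous approximation: if `v` is a C²
solution of `∂ₜv + ∂ₓ(f(t,v)) + h(t,(1−ε)v) = α ∂ₓ(g'(v)w) + ε ∂ₓₓv` on `[0,T] × ℝ` and
`η ∈ C²(ℝ)`, then pointwise
`∂ₜη(v) + ∂ₓ( ∫₀^v ∂_vf(t,ξ)η'(ξ)dξ − αw∫₀^v η'(ξ)g''(ξ)dξ ) + h(t,(1−ε)v)η'(v)
  = ε∂ₓₓ(η(v)) − εη''(v)(∂ₓv)² + α(η'(v)g'(v) − ∫₀^v η'(ξ)g''(ξ)dξ)∂ₓw`. -/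
theorem viscous_entropy_identity
    (α ε T : ℝ) (hα : 0 < α) (hε : ε ∈ Set.Ioo (0:ℝ) 1) (hT : 0 < T)
    (f h : ℝ → ℝ → ℝ)
    (hf : ContDiff ℝ 2 (fun p : ℝ × ℝ => f p.1 p.2))
    (hh : ContDiff ℝ 2 (fun p : ℝ × ℝ => h p.1 p.2))
    (g : ℝ → ℝ) (hg : ContDiff ℝ 3 g)
    (w : ℝ → ℝ → ℝ) (hw : ContDiff ℝ 1 (fun p : ℝ × ℝ => w p.1 p.2))
    (η : ℝ → ℝ) (hη : ContDiff ℝ 2 η)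
    (v : ℝ → ℝ → ℝ)
    (hv : ContDiff ℝ 2 (fun p : ℝ × ℝ => v p.1 p.2))
    (hv_eq : ∀ t ∈ Set.Icc (0:ℝ) T, ∀ x : ℝ,
      deriv (fun s => v s x) t
        + deriv (fun y => f t (v t y)) x
        + h t ((1 - ε) * v t x)
        = α * deriv (fun y => deriv g (v t y) * w t y) x
          + ε * deriv (fun y => deriv (fun y' => v t y') y) x) :
    ∀ t ∈ Set.Icc (0:ℝ) T, ∀ x : ℝ,
      deriv (fun s => η (v s x)) t
        + deriv (fun y =>
            (∫ ξ in (0:ℝ)..(v t y), deriv (fun ζ => f t ζ) ξ * deriv η ξ)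
              - α * w t y * ∫ ξ in (0:ℝ)..(v t y), deriv η ξ * deriv (deriv g) ξ) x
        + h t ((1 - ε) * v t x) * deriv η (v t x)
      = ε * deriv (fun y => deriv (fun y' => η (v t y')) y) x
          - ε * deriv (deriv η) (v t x) * (deriv (fun y => v t y) x) ^ 2
          + α * (deriv η (v t x) * deriv g (v t x)
                - ∫ ξ in (0:ℝ)..(v t x), deriv η ξ * deriv (deriv g) ξ)
              * deriv (fun y => w t y) x := by
  intro t ht x
  have hfs : ContDiff ℝ 2 (fun ζ => f t ζ) :=
    hf.comp (contDiff_const.prodMk contDiff_id : ContDiff ℝ 2 (fun ζ : ℝ => (t, ζ)))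
  have hvs : ContDiff ℝ 2 (fun y => v t y) :=
    hv.comp (contDiff_const.prodMk contDiff_id : ContDiff ℝ 2 (fun ζ : ℝ => (t, ζ)))
  have hvt : ContDiff ℝ 2 (fun s => v s x) :=
    hv.comp (contDiff_id.prodMk contDiff_const : ContDiff ℝ 2 (fun s : ℝ => (s, x)))
  have hws : ContDiff ℝ 1 (fun y => w t y) :=
    hw.comp (contDiff_const.prodMk contDiff_id : ContDiff ℝ 1 (fun ζ : ℝ => (t, ζ)))
  have hη' : ContDiff ℝ 1 (deriv η) := ContDiff.deriv' (n := 1) (by norm_num; exact hη)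
  have hg' : ContDiff ℝ 2 (deriv g) := ContDiff.deriv' (n := 2) (by norm_num; exact hg)
  have hg'' : ContDiff ℝ 1 (deriv (deriv g)) := ContDiff.deriv' (n := 1) (by norm_num; exact hg')
  have hf' : ContDiff ℝ 1 (deriv (fun ζ => f t ζ)) := ContDiff.deriv' (n := 1) (by norm_num; exact hfs)
  have hv' : ContDiff ℝ 1 (deriv (fun y => v t y)) := ContDiff.deriv' (n := 1) (by norm_num; exact hvs)
  have dη : ∀ u, HasDerivAt η (deriv η u) u := fun u =>
    (hη.differentiable (by norm_num) u).hasDerivAt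
  have dη' : ∀ u, HasDerivAt (deriv η) (deriv (deriv η) u) u := fun u =>
    (hη'.differentiable (by norm_num) u).hasDerivAt
  have dg' : ∀ u, HasDerivAt (deriv g) (deriv (deriv g) u) u := fun u =>
    (hg'.differentiable (by norm_num) u).hasDerivAt
  have df : ∀ u, HasDerivAt (fun ζ => f t ζ) (deriv (fun ζ => f t ζ) u) u := fun u =>
    (hfs.differentiable (by norm_num) u).hasDerivAt
  have dv : ∀ y, HasDerivAt (fun y => v t y) (deriv (fun y => v t y) y) y := fun u =>
    (hvs.differentiable (by norm_num) u).hasDerivAt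
  have dv' : HasDerivAt (deriv (fun y => v t y)) (deriv (deriv (fun y => v t y)) x) x :=
    (hv'.differentiable (by norm_num) x).hasDerivAt
  have dvt : HasDerivAt (fun s => v s x) (deriv (fun s => v s x) t) t :=
    (hvt.differentiable (by norm_num) t).hasDerivAt
  have dw : HasDerivAt (fun y => w t y) (deriv (fun y => w t y) x) x :=
    (hws.differentiable (by norm_num) x).hasDerivAt
  have hI : ∀ φ : ℝ → ℝ, Continuous φ →
      HasDerivAt (fun y => ∫ ξ in (0:ℝ)..(v t y), φ ξ)
        (φ (v t x) * deriv (fun y => v t y) x) x := fun φ hφ =>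
    HasDerivAt.comp x (h₂ := fun u => ∫ ξ in (0:ℝ)..u, φ ξ)
      (hφ.integral_hasStrictDerivAt 0 (v t x)).hasDerivAt (dv x)
  have h1 := hI (fun ξ => deriv (fun ζ => f t ζ) ξ * deriv η ξ)
    (hf'.continuous.mul hη'.continuous)
  have h2 := hI (fun ξ => deriv η ξ * deriv (deriv g) ξ)
    (hη'.continuous.mul hg''.continuous)
  have e1 : deriv (fun s => η (v s x)) t = deriv η (v t x) * deriv (fun s => v s x) t :=
    (HasDerivAt.comp t (h₂ := η) (dη (v t x)) dvt).deriv
  have e2 := (h1.fun_sub ((dw.const_mul α).fun_mul h2)).deriv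
  have e3 : (fun y => deriv (fun y' => η (v t y')) y)
      = fun y => deriv η (v t y) * deriv (fun y => v t y) y := by
    funext y
    exact (HasDerivAt.comp y (h₂ := η) (dη (v t y)) (dv y)).deriv
  have c4 : HasDerivAt (fun y => deriv η (v t y))
      (deriv (deriv η) (v t x) * deriv (fun y => v t y) x) x :=
    HasDerivAt.comp x (h₂ := deriv η) (dη' (v t x)) (dv x)
  have e4 := (c4.fun_mul dv').deriv
  have c5 : HasDerivAt (fun y => deriv g (v t y))
      (deriv (deriv g) (v t x) * deriv (fun y => v t y) x) x :=
    HasDerivAt.comp x (h₂ := deriv g) (dg' (v t x)) (dv x)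
  have e5 := (c5.fun_mul dw).deriv
  have e6 : deriv (fun y => f t (v t y)) x
      = deriv (fun ζ => f t ζ) (v t x) * deriv (fun y => v t y) x :=
    (HasDerivAt.comp x (h₂ := fun ζ => f t ζ) (df (v t x)) (dv x)).deriv
  have key := hv_eq t ht x
  rw [e5, e6] at key
  rw [e1, e2, e3, e4]
  linear_combination (deriv η (v t x)) * key
end
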